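/- arXiv:2501.19394 — 6 statements merged into one kernel-verified Lean document; each statement's English description precedes it below -/
import Mathlib

section
/- Let n ≥ 1, let 𝒟 be a finite nonempty set, and let π₀ be a probability mass function on the finite set of assignments ω : Fin n → 𝒟. For each unit i let N(i) ⊆ Fin n, let Y_i : (Fin n → 𝒟) → ℝ, and for each restriction b of an assignment to the complement of N(i) that has positive π₀-marginal probability let π_T^i(b) be a probability mass function on maps N(i) → 𝒟 satisfying absolute continuity: π_T^i(b)(a) > 0 implies π₀(a | b) > 0, where π₀(a | b) is the conditional π₀-probability that the restriction to N(i) equals a given that the restriction to N(i)ᶜ equals b. Define the likelihood-ratio weight r_i(ω) = π_T^i(ω|_{N(i)ᶜ})(ω|_{N(i)}) / π₀(ω|_{N(i)} | ω|_{N(i)ᶜ}), the inverse-probability-weighting estimator V̂(ω) = (1/n) Σ_{i} Y_i(ω) r_i(ω), and the conditional-on-assignment estimand V*(ω) = (1/n) Σ_i Σ_a π_T^i(ω|_{N(i)ᶜ})(a) · Y_i(a ⊕ ω|_{N(i)ᶜ}), where a ⊕ ω|_{N(i)ᶜ} denotes the assignment equal to a on N(i) and to ω off N(i). Then the estimator is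 unbiased: E_{π₀}[V̂ − V*] = 0. -/
open Finset
open scoped BigOperators Classical

noncomputable section

namespace Stmt0

/-- Restriction of an assignment `ω : Fin n → D` to a subset `S` of units. -/
def restrict {D : Type*} {n : ℕ} (S : Finset (Fin n)) (ω : Fin n → D) : ↥S → D :=
  fun j => ω j.1

/-- Combine a partial assignment `a` on `S` with a partial assignment `b` on `Sᶜ`. -/
def combine {D : Type*} {n : ℕ} (S : Finset (Fin n)) (a : ↥S → D) (b : ↥(Sᶜ) → D) :
    Fin n → D :=
  fun j => if h : j ∈ S then a ⟨j, h⟩ else b ⟨j, Finset.mem_compl.mpr h⟩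

/-- Expectation of `f` under the pmf `p` on assignments. -/
def expect {D : Type*} [Fintype D] {n : ℕ} (p : (Fin n → D) → ℝ)
    (f : (Fin n → D) → ℝ) : ℝ :=
  ∑ ω, p ω * f ω

/-- Marginal probability under `p` that the restriction to `Sᶜ` equals `b`. -/
def margOff {D : Type*} [Fintype D] {n : ℕ} (p : (Fin n → D) → ℝ)
    (S : Finset (Fin n)) (b : ↥(Sᶜ) → D) : ℝ :=
  ∑ a : ↥S → D, p (combine S a b)

/-- Conditional probability under `p` that the restriction to `S` equals `a`, given that the
restriction to `Sᶜ` equals `b`. -/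
def condProb {D : Type*} [Fintype D] {n : ℕ} (p : (Fin n → D) → ℝ)
    (S : Finset (Fin n)) (a : ↥S → D) (b : ↥(Sᶜ) → D) : ℝ :=
  p (combine S a b) / margOff p S b

lemma restrict_combine {D : Type*} {n : ℕ} (S : Finset (Fin n)) (a : ↥S → D) (b : ↥(Sᶜ) → D) :
    restrict S (combine S a b) = a := by
  funext j
  simp [restrict, combine]

lemma restrict_compl_combine {D : Type*} {n : ℕ} (S : Finset (Fin n)) (a : ↥S → D)
    (b : ↥(Sᶜ) → D) : restrict (Sᶜ) (combine S a b) = b := by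
  funext j
  have h : j.1 ∉ S := Finset.mem_compl.mp j.2
  simp [restrict, combine, h]

lemma combine_restrict {D : Type*} {n : ℕ} (S : Finset (Fin n)) (ω : Fin n → D) :
    combine S (restrict S ω) (restrict (Sᶜ) ω) = ω := by
  funext j
  by_cases h : j ∈ S <;> simp [restrict, combine, h]

lemma sum_split {D : Type*} [Fintype D] {n : ℕ} (S : Finset (Fin n)) (f : (Fin n → D) → ℝ) :
    ∑ ω, f ω = ∑ b : ↥(Sᶜ) → D, ∑ a : ↥S → D, f (combine S a b) := by
  rw [← Fintype.sum_prod_type' (f := fun b a => f (combine S a b))]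
  refine Fintype.sum_equiv
    { toFun := fun ω => (restrict (Sᶜ) ω, restrict S ω)
      invFun := fun q => combine S q.2 q.1
      left_inv := fun ω => combine_restrict S ω
      right_inv := fun q => by
        simp only [restrict_combine, restrict_compl_combine] } _ _ ?_
  intro ω
  simp only [Equiv.coe_fn_mk, combine_restrict]

lemma unit_unbiased {D : Type*} [Fintype D] {n : ℕ} (p : (Fin n → D) → ℝ)
    (hp0 : ∀ ω, 0 ≤ p ω) (S : Finset (Fin n)) (Y : (Fin n → D) → ℝ)
    (q : (↥(Sᶜ) → D) → (↥S → D) → ℝ)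
    (hq0 : ∀ b, 0 < margOff p S b → ∀ a, 0 ≤ q b a)
    (habs : ∀ b, 0 < margOff p S b → ∀ a, 0 < q b a → 0 < condProb p S a b) :
    ∑ ω, p ω * (Y ω * (q (restrict (Sᶜ) ω) (restrict S ω) /
        condProb p S (restrict S ω) (restrict (Sᶜ) ω))) =
      ∑ ω, p ω * ∑ a : ↥S → D,
        q (restrict (Sᶜ) ω) a * Y (combine S a (restrict (Sᶜ) ω)) := by
  rw [sum_split S, sum_split S]
  refine Finset.sum_congr rfl fun b _ => ?_
  simp only [restrict_combine, restrict_compl_combine]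
  rw [← Finset.sum_mul]
  change _ = margOff p S b * _
  have hm0 : 0 ≤ margOff p S b := Finset.sum_nonneg fun a _ => hp0 _
  rcases hm0.eq_or_lt with hm | hm
  · have hz : ∀ a, p (combine S a b) = 0 := fun a =>
      (Finset.sum_eq_zero_iff_of_nonneg (fun a _ => hp0 (combine S a b))).mp hm.symm a
        (Finset.mem_univ a)
    simp [hz, ← hm]
  · rw [Finset.mul_sum]
    refine Finset.sum_congr rfl fun a _ => ?_
    by_cases hc : p (combine S a b) = 0
    · have hq : q b a = 0 := by
        by_contra hne
        have := habs b hm a (lt_of_le_of_ne (hq0 b hm a) (Ne.symm hne))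
        simp [condProb, hc] at this
      simp [hq]
    · have hm' := hm.ne'
      unfold condProb
      field_simp

/-- **Unbiasedness of the IPW estimator for conditional-on-assignment average counterfactuals.**
`E_{π₀}[V̂ − V*] = 0`. -/
theorem unbiasedness
    (n : ℕ) (hn : 1 ≤ n)
    (D : Type*) [Fintype D] [DecidableEq D] [Nonempty D]
    (p : (Fin n → D) → ℝ)
    (hp0 : ∀ ω, 0 ≤ p ω) (hp1 : ∑ ω, p ω = 1)
    (N : Fin n → Finset (Fin n))
    (Y : Fin n → (Fin n → D) → ℝ)
    (πT : ∀ i : Fin n, (↥((N i)ᶜ) → D) → (↥(N i) → D) → ℝ)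
    (hπT0 : ∀ i b, 0 < margOff p (N i) b → ∀ a, 0 ≤ πT i b a)
    (hπT1 : ∀ i b, 0 < margOff p (N i) b → ∑ a, πT i b a = 1)
    (habs : ∀ i b, 0 < margOff p (N i) b → ∀ a, 0 < πT i b a → 0 < condProb p (N i) a b) :
    expect p (fun ω =>
        ((1 : ℝ) / n) * ∑ i, Y i ω *
            (πT i (restrict ((N i)ᶜ) ω) (restrict (N i) ω) /
              condProb p (N i) (restrict (N i) ω) (restrict ((N i)ᶜ) ω))
      - ((1 : ℝ) / n) * ∑ i, ∑ a : ↥(N i) → D,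
          πT i (restrict ((N i)ᶜ) ω) a * Y i (combine (N i) a (restrict ((N i)ᶜ) ω))) = 0 := by
  unfold expect
  simp only [mul_sub, Finset.sum_sub_distrib]
  rw [sub_eq_zero]
  simp only [mul_left_comm _ ((1 : ℝ) / n)]
  rw [← Finset.mul_sum, ← Finset.mul_sum]
  congr 1
  simp only [Finset.mul_sum _ _ (p _)]
  rw [Finset.sum_comm]
  conv_rhs => rw [Finset.sum_comm]
  refine Finset.sum_congr rfl fun i _ => ?_
  have h := unit_unbiased p hp0 (N i) (Y i) (πT i) (hπT0 i) (habs i)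
  simp only [Finset.mul_sum] at h
  convert h

end Stmt0
end
end

section
/- Fix a real constant B_Y > 0. For each n ≥ 1 consider the following data: a finite nonempty set 𝒟, a probability mass function π₀ on assignments ω : Fin n → 𝒟, for each unit i a set N(i) ⊆ Fin n, a designated configuration d*_i : N(i) → 𝒟 with π₀(d*_i | b) > 0 for every b with positive marginal probability, and a potential-outcome map Y_i : (Fin n → 𝒟) → ℝ with |Y_i(ω)| ≤ B_Y for all ω. Define r_i(ω) = 1{ω|_{N(i)} = d*_i} / π₀(d*_i | ω|_{N(i)ᶜ}), V̂_n(ω) = (1/n) Σ_i Y_i(ω) r_i(ω) and V*_n(ω) = (1/n) Σ_i Y_i(d*_i ⊕ ω|_{N(i)ᶜ}). Assume there are constants B_{T,n}, A_n, C_n such that: (i) Var_{π₀}(r_i) ≤ B_{T,n} for every i; (ii) for each i there is a set A(i) ⊇ N(i) such that under π₀ the restriction ω|_{A(i)ᶜ} is independent of ω|_{N(i)}, the number of units j with A(i) ∩ A(j) ≠ ∅ is at most A_n, and for any pair i ≠ j with A(i) ∩ A(j) = ∅ the restrictions ω|_{N(i)} and ω|_{N(j)} are conditionally independent given ω|_{(N(i)∪N(j))ᶜ};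 (iii) defining the oscillation φ_{ij}(ω) = max_{d : A(i)→𝒟} Y_j(d*_j ⊕ d ⊕ ω|_{(A(i)∪N(j))ᶜ}) − min_{d : A(i)→𝒟} Y_j(d*_j ⊕ d ⊕ ω|_{(A(i)∪N(j))ᶜ}), one has (1/n) Σ_{i ≠ j} E_{π₀}|φ_{ij}| ≤ C_n for every j. If B_{T,n} A_n / n → 0 and B_{T,n} C_n² → 0 as n → ∞, then V̂_n − V*_n converges to 0 in probability: for every ε > 0, π₀(|V̂_n − V*_n| > ε) → 0. -/
open Finset Filter
open scoped BigOperators Classical Topology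

noncomputable section

namespace Stmt1

/-- Restriction of an assignment `ω : Fin n → D` to a subset `S` of units. -/
def restrict {D : Type*} {n : ℕ} (S : Finset (Fin n)) (ω : Fin n → D) : ↥S → D :=
  fun j => ω j.1

/-- Combine a partial assignment `a` on `S` with a partial assignment `b` on `Sᶜ`. -/
def combine {D : Type*} {n : ℕ} (S : Finset (Fin n)) (a : ↥S → D) (b : ↥(Sᶜ) → D) :
    Fin n → D :=
  fun j => if h : j ∈ S then a ⟨j, h⟩ else b ⟨j, Finset.mem_compl.mpr h⟩

/-- The assignment equal to `a` on `S`, to `d` on `T \ S`, and to `ω` elsewhere. -/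
def patch3 {D : Type*} {n : ℕ} (S T : Finset (Fin n)) (a : ↥S → D) (d : ↥T → D)
    (ω : Fin n → D) : Fin n → D :=
  fun j => if h : j ∈ S then a ⟨j, h⟩ else if h2 : j ∈ T then d ⟨j, h2⟩ else ω j

/-- Expectation of `f` under the pmf `p` on assignments. -/
def expect {D : Type*} [Fintype D] {n : ℕ} (p : (Fin n → D) → ℝ)
    (f : (Fin n → D) → ℝ) : ℝ :=
  ∑ ω, p ω * f ω

/-- Probability of the event `E` under the pmf `p`. -/
def probEvent {D : Type*} [Fintype D] {n : ℕ} (p : (Fin n → D) → ℝ)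
    (E : (Fin n → D) → Prop) : ℝ :=
  ∑ ω, if E ω then p ω else 0

/-- Variance of `f` under the pmf `p`. -/
def var {D : Type*} [Fintype D] {n : ℕ} (p : (Fin n → D) → ℝ)
    (f : (Fin n → D) → ℝ) : ℝ :=
  expect p (fun ω => (f ω - expect p f) ^ 2)

/-- Marginal probability under `p` that the restriction to `Sᶜ` equals `b`. -/
def margOff {D : Type*} [Fintype D] {n : ℕ} (p : (Fin n → D) → ℝ)
    (S : Finset (Fin n)) (b : ↥(Sᶜ) → D) : ℝ :=
  ∑ a : ↥S → D, p (combine S a b)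

/-- Conditional probability under `p` that the restriction to `S` equals `a`, given that the
restriction to `Sᶜ` equals `b`. -/
def condProb {D : Type*} [Fintype D] {n : ℕ} (p : (Fin n → D) → ℝ)
    (S : Finset (Fin n)) (a : ↥S → D) (b : ↥(Sᶜ) → D) : ℝ :=
  p (combine S a b) / margOff p S b

/-- The single-configuration inverse-probability weight
`r(ω) = 1{ω|_S = d*} / π₀(d* | ω|_{Sᶜ})`. -/
def weight {D : Type*} [Fintype D] {n : ℕ} (p : (Fin n → D) → ℝ)
    (S : Finset (Fin n)) (dstar : ↥S → D) (ω : Fin n → D) : ℝ :=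
  (if restrict S ω = dstar then (1 : ℝ) else 0) / condProb p S dstar (restrict (Sᶜ) ω)

/-- The IPW estimator `V̂(ω) = (1/n) Σ_i Y_i(ω) r_i(ω)`. -/
def Vhat {D : Type*} [Fintype D] {n : ℕ} (p : (Fin n → D) → ℝ)
    (N : Fin n → Finset (Fin n)) (dstar : ∀ i : Fin n, ↥(N i) → D)
    (Y : Fin n → (Fin n → D) → ℝ) (ω : Fin n → D) : ℝ :=
  ((1 : ℝ) / n) * ∑ i, Y i ω * weight p (N i) (dstar i) ω

/-- The conditional-on-assignment estimand `V*(ω) = (1/n) Σ_i Y_i(d*_i ⊕ ω|_{N(i)ᶜ})`. -/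
def Vstar {D : Type*} {n : ℕ}
    (N : Fin n → Finset (Fin n)) (dstar : ∀ i : Fin n, ↥(N i) → D)
    (Y : Fin n → (Fin n → D) → ℝ) (ω : Fin n → D) : ℝ :=
  ((1 : ℝ) / n) * ∑ i, Y i (combine (N i) (dstar i) (restrict ((N i)ᶜ) ω))

/-- Oscillation of `Yj` (with exposure configuration fixed at `a` on `S`) over all assignments
`d` on `T`, holding the assignment off `S ∪ T` fixed at `ω`:
`max_d Yj(a ⊕ d ⊕ ω) − min_d Yj(a ⊕ d ⊕ ω)`. -/
def osc {D : Type*} {n : ℕ} (S T : Finset (Fin n)) (a : ↥S → D)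
    (Yj : (Fin n → D) → ℝ) (ω : Fin n → D) : ℝ :=
  sSup (Set.range fun d : ↥T → D => Yj (patch3 S T a d ω)) -
    sInf (Set.range fun d : ↥T → D => Yj (patch3 S T a d ω))

/-- Independence under `p` of the restrictions of the assignment to `S` and to `T`. -/
def indep {D : Type*} [Fintype D] {n : ℕ} (p : (Fin n → D) → ℝ)
    (S T : Finset (Fin n)) : Prop :=
  ∀ (a : ↥S → D) (b : ↥T → D),
    probEvent p (fun ω => restrict S ω = a ∧ restrict T ω = b) =
      probEvent p (fun ω => restrict S ω = a) * probEvent p (fun ω => restrict T ω = b)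

/-- Conditional independence under `p` of the restrictions to `S` and `T`, given the
restriction of the assignment to `U`. -/
def condIndep {D : Type*} [Fintype D] {n : ℕ} (p : (Fin n → D) → ℝ)
    (S T U : Finset (Fin n)) : Prop :=
  ∀ (a : ↥S → D) (b : ↥T → D) (c : ↥U → D),
    probEvent p (fun ω => restrict U ω = c) *
        probEvent p (fun ω => restrict S ω = a ∧ restrict T ω = b ∧ restrict U ω = c) =
      probEvent p (fun ω => restrict S ω = a ∧ restrict U ω = c) *
        probEvent p (fun ω => restrict T ω = b ∧ restrict U ω = c)

/-- `F` does not depend on the coordinates in `S`. -/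
def Off {D : Type*} {n : ℕ} (S : Finset (Fin n)) (F : (Fin n → D) → ℝ) : Prop :=
  ∀ ω ω' : Fin n → D, (∀ k, k ∉ S → ω k = ω' k) → F ω = F ω'

/-- Splitting an assignment. -/
def splitEquiv {D : Type*} {n : ℕ} (S : Finset (Fin n)) :
    ((↥S → D) × (↥(Sᶜ) → D)) ≃ (Fin n → D) where
  toFun x := combine S x.1 x.2
  invFun ω := (restrict S ω, restrict (Sᶜ) ω)
  left_inv := by
    rintro ⟨a, b⟩
    ext k
    · simp [restrict, combine]
    · have := k.2
      rw [Finset.mem_compl] at this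
      simp [restrict, combine, this]
  right_inv := by
    intro ω
    ext k
    by_cases h : k ∈ S <;> simp [restrict, combine, h]

lemma restrict_combine {D : Type*} {n : ℕ} (S : Finset (Fin n)) (a : ↥S → D) (b : ↥(Sᶜ) → D) :
    restrict S (combine S a b) = a :=
  congrArg Prod.fst ((splitEquiv S).left_inv (a, b))

lemma restrict_compl_combine {D : Type*} {n : ℕ} (S : Finset (Fin n)) (a : ↥S → D)
    (b : ↥(Sᶜ) → D) : restrict (Sᶜ) (combine S a b) = b :=
  congrArg Prod.snd ((splitEquiv S).left_inv (a, b))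

lemma combine_restrict {D : Type*} {n : ℕ} (S : Finset (Fin n)) (ω : Fin n → D) :
    combine S (restrict S ω) (restrict (Sᶜ) ω) = ω :=
  (splitEquiv S).right_inv ω

lemma sum_split {D : Type*} [Fintype D] {n : ℕ} (S : Finset (Fin n)) (f : (Fin n → D) → ℝ) :
    ∑ ω, f ω = ∑ b : ↥(Sᶜ) → D, ∑ a : ↥S → D, f (combine S a b) := by
  rw [← (splitEquiv S).sum_comp, Fintype.sum_prod_type_right]
  rfl

lemma margOff_eq {D : Type*} [Fintype D] {n : ℕ} (p : (Fin n → D) → ℝ)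
    (S : Finset (Fin n)) (b : ↥(Sᶜ) → D) :
    margOff p S b = probEvent p (fun ω => restrict (Sᶜ) ω = b) := by
  unfold probEvent margOff
  rw [sum_split S, Finset.sum_comm]
  simp [restrict_compl_combine]

lemma point_eq {D : Type*} [Fintype D] {n : ℕ} (p : (Fin n → D) → ℝ)
    (S : Finset (Fin n)) (a : ↥S → D) (b : ↥(Sᶜ) → D) :
    p (combine S a b) = probEvent p (fun ω => restrict S ω = a ∧ restrict (Sᶜ) ω = b) := by
  unfold probEvent
  rw [sum_split S]
  simp only [restrict_compl_combine, restrict_combine]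
  rw [Finset.sum_eq_single b, Finset.sum_eq_single a] <;> simp +contextual

lemma probEvent_ge {D : Type*} [Fintype D] {n : ℕ} (p : (Fin n → D) → ℝ) (hp : ∀ ω, 0 ≤ p ω)
    (E : (Fin n → D) → Prop) (ω : Fin n → D) (h : E ω) : p ω ≤ probEvent p E := by
  unfold probEvent
  have := Finset.single_le_sum (f := fun ω => if E ω then p ω else 0)
    (fun i _ => by split_ifs; exacts [hp i, le_rfl]) (Finset.mem_univ ω)
  simpa [h] using this

lemma condProb_nonneg {D : Type*} [Fintype D] {n : ℕ} (p : (Fin n → D) → ℝ) (hp : ∀ ω, 0 ≤ p ω)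
    (S : Finset (Fin n)) (a : ↥S → D) (b : ↥(Sᶜ) → D) : 0 ≤ condProb p S a b :=
  div_nonneg (hp _) (Finset.sum_nonneg fun _ _ => hp _)

lemma weight_nonneg {D : Type*} [Fintype D] {n : ℕ} (p : (Fin n → D) → ℝ) (hp : ∀ ω, 0 ≤ p ω)
    (S : Finset (Fin n)) (a : ↥S → D) (ω) : 0 ≤ weight p S a ω :=
  div_nonneg (by split_ifs <;> norm_num) (condProb_nonneg p hp _ _ _)

/-- Conditional mean one of the weights. -/
lemma key {D : Type*} [Fintype D] {n : ℕ} (p : (Fin n → D) → ℝ) (hp : ∀ ω, 0 ≤ p ω)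
    (S : Finset (Fin n)) (d : ↥S → D)
    (hpos : ∀ b, 0 < margOff p S b → 0 < condProb p S d b)
    (G : (Fin n → D) → ℝ) (hG : Off S G) :
    ∑ ω, p ω * (G ω * weight p S d ω) = ∑ ω, p ω * G ω := by
  rw [sum_split S, sum_split S]
  refine Finset.sum_congr rfl fun b _ => ?_
  have hGb : ∀ a, G (combine S a b) = G (combine S d b) := fun a =>
    hG _ _ fun k hk => by simp [combine, hk]
  have h1 : ∑ a, p (combine S a b) * G (combine S a b) = margOff p S b * G (combine S d b) := by
    unfold margOff
    rw [Finset.sum_mul]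
    exact Finset.sum_congr rfl fun a _ => by rw [hGb]
  rw [h1, Finset.sum_eq_single d]
  · unfold weight
    rw [restrict_combine, restrict_compl_combine, if_pos rfl]
    have hm : 0 ≤ margOff p S b := Finset.sum_nonneg fun _ _ => hp _
    rcases hm.eq_or_lt with h0 | h0
    · have : p (combine S d b) = 0 := by
        have := (Finset.sum_eq_zero_iff_of_nonneg (fun a _ => hp (combine S a b))).1 h0.symm
        exact this d (Finset.mem_univ _)
      rw [this, ← h0]; simp
    · have h2 := hpos b h0
      unfold condProb at h2 ⊢
      have h3 : p (combine S d b) ≠ 0 := by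
        intro h; rw [h] at h2; simp at h2
      have h4 := h0.ne'
      field_simp
  · intro a _ ha
    unfold weight
    rw [restrict_combine, if_neg ha]; simp
  · simp

/-- Under conditional independence the weight of `S₂` does not depend on `S₁`, a.s. -/
lemma exists_rho {D : Type*} [Fintype D] {n : ℕ} (p : (Fin n → D) → ℝ) (hp : ∀ ω, 0 ≤ p ω)
    (S₁ S₂ : Finset (Fin n)) (hd : Disjoint S₁ S₂) (d : ↥S₂ → D)
    (hci : condIndep p S₁ S₂ ((S₁ ∪ S₂)ᶜ)) :
    ∃ ρ : (Fin n → D) → ℝ, Off S₁ ρ ∧ ∀ ω, p ω ≠ 0 → weight p S₂ d ω = ρ ω := by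
  refine ⟨fun ω => (if restrict S₂ ω = d then (1 : ℝ) else 0) /
    (probEvent p (fun ω' => restrict S₂ ω' = d ∧
        restrict ((S₁ ∪ S₂)ᶜ) ω' = restrict ((S₁ ∪ S₂)ᶜ) ω) /
      probEvent p (fun ω' => restrict ((S₁ ∪ S₂)ᶜ) ω' = restrict ((S₁ ∪ S₂)ᶜ) ω)), ?_, ?_⟩
  · intro ω ω' h
    have h1 : restrict S₂ ω = restrict S₂ ω' := by
      ext k
      exact h k.1 (fun hk => (Finset.disjoint_left.1 hd hk) k.2)
    have h2 : restrict ((S₁ ∪ S₂)ᶜ) ω = restrict ((S₁ ∪ S₂)ᶜ) ω' := by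
      ext k
      have := k.2
      simp only [Finset.mem_compl, Finset.mem_union, not_or] at this
      exact h k.1 this.1
    simp only [h1, h2]
  · intro ω hω
    have hω' : 0 < p ω := lt_of_le_of_ne (hp ω) (Ne.symm hω)
    unfold weight
    congr 1
    unfold condProb
    have hiff : ∀ ω' : Fin n → D, (restrict (S₂ᶜ) ω' = restrict (S₂ᶜ) ω ↔
        (restrict S₁ ω' = restrict S₁ ω ∧
          restrict ((S₁ ∪ S₂)ᶜ) ω' = restrict ((S₁ ∪ S₂)ᶜ) ω)) := by
      intro ω'
      simp only [funext_iff, restrict, Subtype.forall, Finset.mem_compl, Finset.mem_union, not_or]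
      constructor
      · intro h
        exact ⟨fun k hk => h k (Finset.disjoint_left.1 hd hk), fun k hk => h k hk.2⟩
      · rintro ⟨h1, h2⟩ k hk
        by_cases hk1 : k ∈ S₁
        · exact h1 k hk1
        · exact h2 k ⟨hk1, hk⟩
    have hc := hci (restrict S₁ ω) d (restrict ((S₁ ∪ S₂)ᶜ) ω)
    rw [point_eq p S₂ d, margOff_eq]
    have e1 : (fun ω' : Fin n → D => restrict (S₂ᶜ) ω' = restrict (S₂ᶜ) ω) =
        (fun ω' => restrict S₁ ω' = restrict S₁ ω ∧
          restrict ((S₁ ∪ S₂)ᶜ) ω' = restrict ((S₁ ∪ S₂)ᶜ) ω) := by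
      ext ω'; exact hiff ω'
    have e2 : (fun ω' : Fin n → D => restrict S₂ ω' = d ∧ restrict (S₂ᶜ) ω' = restrict (S₂ᶜ) ω) =
        (fun ω' => restrict S₁ ω' = restrict S₁ ω ∧ restrict S₂ ω' = d ∧
          restrict ((S₁ ∪ S₂)ᶜ) ω' = restrict ((S₁ ∪ S₂)ᶜ) ω) := by
      ext ω'; rw [hiff ω']; tauto
    rw [e1, e2]
    have p1 := lt_of_lt_of_le hω' (probEvent_ge p hp (fun ω' => restrict S₁ ω' = restrict S₁ ω ∧
          restrict ((S₁ ∪ S₂)ᶜ) ω' = restrict ((S₁ ∪ S₂)ᶜ) ω) ω ⟨rfl, rfl⟩)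
    have p2 := lt_of_lt_of_le hω' (probEvent_ge p hp (fun ω' => 
          restrict ((S₁ ∪ S₂)ᶜ) ω' = restrict ((S₁ ∪ S₂)ᶜ) ω) ω rfl)
    rw [div_eq_div_iff p1.ne' p2.ne']
    linarith

lemma pair_bound {D : Type*} [Fintype D] {n : ℕ} (p : (Fin n → D) → ℝ) (hp : ∀ ω, 0 ≤ p ω)
    (S₁ S₂ : Finset (Fin n)) (hd : Disjoint S₁ S₂) (d₁ : ↥S₁ → D) (d₂ : ↥S₂ → D)
    (hpos₁ : ∀ b, 0 < margOff p S₁ b → 0 < condProb p S₁ d₁ b)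
    (hpos₂ : ∀ b, 0 < margOff p S₂ b → 0 < condProb p S₂ d₂ b)
    (hci : condIndep p S₁ S₂ ((S₁ ∪ S₂)ᶜ))
    (F G m φ : (Fin n → D) → ℝ) (B : ℝ) (hF : Off S₁ F) (hFB : ∀ ω, |F ω| ≤ B)
    (hm : Off S₁ m) (hφ₁ : Off S₁ φ) (hφ₂ : Off S₂ φ)
    (hG : ∀ ω, |G ω - m ω| ≤ φ ω) :
    ∑ ω, p ω * ((F ω * (weight p S₁ d₁ ω - 1)) * (G ω * (weight p S₂ d₂ ω - 1)))
      ≤ 4 * B * ∑ ω, p ω * φ ω := by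
  obtain ⟨ρ, hρ, hw⟩ := exists_rho p hp S₁ S₂ hd d₂ hci
  set W₁ := weight p S₁ d₁ with hW₁
  set W₂ := weight p S₂ d₂ with hW₂
  have hW₁0 : ∀ ω, 0 ≤ W₁ ω := weight_nonneg p hp S₁ d₁
  have hW₂0 : ∀ ω, 0 ≤ W₂ ω := weight_nonneg p hp S₂ d₂
  have hrep : ∀ f : (Fin n → D) → ℝ → ℝ, ∑ ω, p ω * f ω (W₂ ω) = ∑ ω, p ω * f ω (ρ ω) := by
    intro f
    refine Finset.sum_congr rfl fun ω _ => ?_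
    by_cases h : p ω = 0
    · simp [h]
    · rw [hw ω h]
  -- centred part vanishes
  have hzero : ∑ ω, p ω * (F ω * (W₁ ω - 1) * (m ω * (W₂ ω - 1))) = 0 := by
    rw [hrep (fun ω x => F ω * (W₁ ω - 1) * (m ω * (x - 1)))]
    have := key p hp S₁ d₁ hpos₁ (fun ω => F ω * m ω * (ρ ω - 1))
      (fun ω ω' h => by simp only [hF ω ω' h, hm ω ω' h, hρ ω ω' h])
    rw [← sub_eq_zero, ← Finset.sum_sub_distrib] at this
    rw [← this]
    exact Finset.sum_congr rfl fun ω _ => by ring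
  have hle : ∑ ω, p ω * ((F ω * (W₁ ω - 1)) * (G ω * (W₂ ω - 1))) ≤
      ∑ ω, p ω * (F ω * (W₁ ω - 1) * (m ω * (W₂ ω - 1))) +
      ∑ ω, p ω * (B * (W₁ ω + 1) * φ ω * (W₂ ω + 1)) := by
    rw [← Finset.sum_add_distrib]
    refine Finset.sum_le_sum fun ω _ => ?_
    rw [← mul_add]
    refine mul_le_mul_of_nonneg_left ?_ (hp ω)
    have : (F ω * (W₁ ω - 1)) * ((G ω - m ω) * (W₂ ω - 1)) ≤
        B * (W₁ ω + 1) * (φ ω * (W₂ ω + 1)) := by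
      refine (le_abs_self _).trans ?_
      rw [abs_mul, abs_mul, abs_mul]
      have a1 : |W₁ ω - 1| ≤ W₁ ω + 1 := abs_le.2 ⟨by linarith [hW₁0 ω], by linarith [hW₁0 ω]⟩
      have a2 : |W₂ ω - 1| ≤ W₂ ω + 1 := abs_le.2 ⟨by linarith [hW₂0 ω], by linarith [hW₂0 ω]⟩
      have a3 : 0 ≤ B := (abs_nonneg _).trans (hFB ω)
      have a4 : 0 ≤ φ ω := (abs_nonneg _).trans (hG ω)
      have a5 := hW₁0 ω
      have := hFB ω
      have := hG ω
      gcongr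
    linarith
  have hsum : ∑ ω, p ω * (B * (W₁ ω + 1) * φ ω * (W₂ ω + 1)) = 4 * B * ∑ ω, p ω * φ ω := by
    rw [hrep (fun ω x => B * (W₁ ω + 1) * φ ω * (x + 1))]
    have k1 := key p hp S₁ d₁ hpos₁ (fun ω => φ ω * (ρ ω + 1))
      (fun ω ω' h => by simp only [hφ₁ ω ω' h, hρ ω ω' h])
    have k2 := key p hp S₂ d₂ hpos₂ φ hφ₂
    have k3 := hrep (fun ω x => φ ω * (x + 1))
    have e1 : ∑ ω, p ω * (B * (W₁ ω + 1) * φ ω * (ρ ω + 1)) =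
        B * (∑ ω, p ω * (φ ω * (ρ ω + 1) * W₁ ω) + ∑ ω, p ω * (φ ω * (ρ ω + 1))) := by
      rw [← Finset.sum_add_distrib, Finset.mul_sum]
      exact Finset.sum_congr rfl fun ω _ => by ring
    have e2 : ∑ ω, p ω * (φ ω * (W₂ ω + 1)) =
        ∑ ω, p ω * (φ ω * W₂ ω) + ∑ ω, p ω * φ ω := by
      rw [← Finset.sum_add_distrib]
      exact Finset.sum_congr rfl fun ω _ => by ring
    rw [e1, k1, ← k3, e2, k2]; ring
  linarith

lemma osc_off {D : Type*} {n : ℕ} (S T : Finset (Fin n)) (a : ↥S → D)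
    (Yj : (Fin n → D) → ℝ) (R : Finset (Fin n)) (hR : R ⊆ S ∪ T) :
    Off R (fun ω => sInf (Set.range fun d : ↥T → D => Yj (patch3 S T a d ω))) ∧
    Off R (osc S T a Yj) := by
  have : ∀ ω ω' : Fin n → D, (∀ k, k ∉ R → ω k = ω' k) → ∀ d : ↥T → D,
      patch3 S T a d ω = patch3 S T a d ω' := by
    intro ω ω' h d
    ext k
    unfold patch3
    split_ifs with h1 h2
    · rfl
    · rfl
    · exact h k fun hk => by simpa [h1, h2] using hR hk
  refine ⟨fun ω ω' h => ?_, fun ω ω' h => ?_⟩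
  · simp only [this ω ω' h]
  · simp only [osc, this ω ω' h]

lemma osc_bound {D : Type*} [Fintype D] {n : ℕ} (S T : Finset (Fin n)) (a : ↥S → D)
    (Yj : (Fin n → D) → ℝ) (ω : Fin n → D) :
    |Yj (combine S a (restrict (Sᶜ) ω)) -
      sInf (Set.range fun d : ↥T → D => Yj (patch3 S T a d ω))| ≤ osc S T a Yj ω := by
  have e : combine S a (restrict (Sᶜ) ω) = patch3 S T a (restrict T ω) ω := by
    ext k
    unfold combine patch3 restrict
    split_ifs <;> rfl
  have hmem : Yj (combine S a (restrict (Sᶜ) ω)) ∈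
      Set.range fun d : ↥T → D => Yj (patch3 S T a d ω) := ⟨restrict T ω, by rw [e]⟩
  have hfin := Set.finite_range fun d : ↥T → D => Yj (patch3 S T a d ω)
  have h1 := csInf_le hfin.bddBelow hmem
  have h2 := le_csSup hfin.bddAbove hmem
  rw [abs_of_nonneg (by linarith)]
  unfold osc
  linarith

/-- The two second-moment bounds for a fixed sample size. -/
lemma second_moment {D : Type*} [Fintype D] {n : ℕ} (hn : 1 ≤ n)
    (p : (Fin n → D) → ℝ) (hp : ∀ ω, 0 ≤ p ω) (hp1 : ∑ ω, p ω = 1)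
    (N : Fin n → Finset (Fin n)) (dstar : ∀ i : Fin n, ↥(N i) → D)
    (Y : Fin n → (Fin n → D) → ℝ) (A : Fin n → Finset (Fin n)) (B BT An Cn : ℝ) (hB : 0 < B)
    (hY : ∀ i ω, |Y i ω| ≤ B)
    (hpos : ∀ i b, 0 < margOff p (N i) b → 0 < condProb p (N i) (dstar i) b)
    (hvar : ∀ i, var p (weight p (N i) (dstar i)) ≤ BT)
    (hA_sub : ∀ i, N i ⊆ A i)
    (hA_card : ∀ i, ((Finset.univ.filter fun j => (A i ∩ A j).Nonempty).card : ℝ) ≤ An)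
    (hci : ∀ i j, i ≠ j → A i ∩ A j = ∅ → condIndep p (N i) (N j) ((N i ∪ N j)ᶜ))
    (hosc : ∀ j, ((1 : ℝ) / n) * ∑ i ∈ Finset.univ.filter (· ≠ j),
          expect p (fun ω => |osc (N j) (A i) (dstar j) (Y j) ω|) ≤ Cn) :
    0 ≤ BT ∧ 0 ≤ Cn ∧
    ∑ ω, p ω * (Vhat p N dstar Y ω - Vstar N dstar Y ω) ^ 2 ≤ B ^ 2 * BT ∧
    ∑ ω, p ω * (Vhat p N dstar Y ω - Vstar N dstar Y ω) ^ 2 ≤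
      B ^ 2 * (BT * An / n) + 4 * B * Cn := by
  have hn' : (0 : ℝ) < n := by exact_mod_cast hn
  set W : Fin n → (Fin n → D) → ℝ := fun i => weight p (N i) (dstar i) with hW
  set F : Fin n → (Fin n → D) → ℝ :=
    fun i ω => Y i (combine (N i) (dstar i) (restrict ((N i)ᶜ) ω)) with hF
  set Z : Fin n → (Fin n → D) → ℝ := fun i ω => F i ω * (W i ω - 1) with hZ
  have hFB : ∀ i ω, |F i ω| ≤ B := fun i ω => hY i _
  have hFoff : ∀ i, Off (N i) (F i) := by
    intro i ω ω' h
    have : restrict ((N i)ᶜ) ω = restrict ((N i)ᶜ) ω' := by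
      ext k
      exact h k.1 (Finset.mem_compl.1 k.2)
    simp only [hF, this]
  have hX : ∀ ω, Vhat p N dstar Y ω - Vstar N dstar Y ω = (1 / n) * ∑ i, Z i ω := by
    intro ω
    unfold Vhat Vstar
    rw [← mul_sub, ← Finset.sum_sub_distrib]
    congr 1
    refine Finset.sum_congr rfl fun i _ => ?_
    have : Y i ω * W i ω = F i ω * W i ω := by
      by_cases h : restrict (N i) ω = dstar i
      · have : combine (N i) (dstar i) (restrict ((N i)ᶜ) ω) = ω := by
          rw [← h]; exact combine_restrict _ _
        simp only [hF, this]
      · have : W i ω = 0 := by simp [hW, weight, h]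
        rw [this]; simp
    change Y i ω * W i ω - F i ω = F i ω * (W i ω - 1)
    rw [this]; ring
  -- mean one
  have hmean : ∀ i, expect p (W i) = 1 := by
    intro i
    have := key p hp (N i) (dstar i) (hpos i) (fun _ => 1) (fun _ _ _ => rfl)
    simp only [one_mul, mul_one, hp1] at this
    exact this
  have hvar' : ∀ i, ∑ ω, p ω * (W i ω - 1) ^ 2 ≤ BT := by
    intro i
    have := hvar i
    unfold var at this
    change expect p (fun ω => (W i ω - expect p (W i)) ^ 2) ≤ BT at this
    rw [hmean i] at this
    exact this
  have hZ2 : ∀ i, ∑ ω, p ω * (Z i ω) ^ 2 ≤ B ^ 2 * BT := by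
    intro i
    calc ∑ ω, p ω * (Z i ω) ^ 2 ≤ ∑ ω, B ^ 2 * (p ω * (W i ω - 1) ^ 2) := by
          refine Finset.sum_le_sum fun ω _ => ?_
          have h1 : (F i ω) ^ 2 ≤ B ^ 2 := sq_le_sq' (abs_le.1 (hFB i ω)).1 (abs_le.1 (hFB i ω)).2
          have h2 : 0 ≤ p ω * (W i ω - 1) ^ 2 := mul_nonneg (hp ω) (sq_nonneg _)
          calc p ω * (Z i ω) ^ 2 = (F i ω) ^ 2 * (p ω * (W i ω - 1) ^ 2) := by
                simp only [hZ]; ring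
            _ ≤ _ := mul_le_mul_of_nonneg_right h1 h2
      _ = B ^ 2 * ∑ ω, p ω * (W i ω - 1) ^ 2 := by rw [Finset.mul_sum]
      _ ≤ _ := mul_le_mul_of_nonneg_left (hvar' i) (sq_nonneg _)
  let i0 : Fin n := ⟨0, hn⟩
  have hBT : 0 ≤ BT :=
    (Finset.sum_nonneg fun ω _ => mul_nonneg (hp ω) (sq_nonneg _)).trans (hvar' i0)
  set Φ : Fin n → Fin n → ℝ :=
    fun i j => expect p (fun ω => |osc (N j) (A i) (dstar j) (Y j) ω|) with hΦ
  have hΦ0 : ∀ i j, 0 ≤ Φ i j := fun i j =>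
    Finset.sum_nonneg fun ω _ => mul_nonneg (hp ω) (abs_nonneg _)
  have hCn : 0 ≤ Cn :=
    (mul_nonneg (by positivity) (Finset.sum_nonneg fun i _ => hΦ0 i i0)).trans (hosc i0)
  have hosc' : ∀ j, ∑ i ∈ Finset.univ.filter (· ≠ j), Φ i j ≤ n * Cn := by
    intro j
    have := hosc j
    rw [one_div, inv_mul_le_iff₀ hn'] at this
    exact this
  refine ⟨hBT, hCn, ?_, ?_⟩
  · calc ∑ ω, p ω * (Vhat p N dstar Y ω - Vstar N dstar Y ω) ^ 2
        ≤ ∑ ω, (1 / n) * ∑ i, p ω * (Z i ω) ^ 2 := by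
          refine Finset.sum_le_sum fun ω _ => ?_
          rw [hX, ← Finset.mul_sum]
          have := sq_sum_le_card_mul_sum_sq (s := (Finset.univ : Finset (Fin n)))
            (f := fun i => Z i ω)
          rw [Finset.card_univ, Fintype.card_fin] at this
          have h2 : (1 / (n : ℝ) * ∑ i, Z i ω) ^ 2 ≤ 1 / n * ∑ i, (Z i ω) ^ 2 := by
            calc (1 / (n : ℝ) * ∑ i, Z i ω) ^ 2 = (1 / (n : ℝ)) ^ 2 * (∑ i, Z i ω) ^ 2 := by ring
              _ ≤ (1 / (n : ℝ)) ^ 2 * (n * ∑ i, (Z i ω) ^ 2) := by gcongr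
              _ = _ := by field_simp
          calc _ ≤ p ω * (1 / n * ∑ i, (Z i ω) ^ 2) := mul_le_mul_of_nonneg_left h2 (hp ω)
            _ = _ := by ring
      _ = (1 / n) * ∑ i, ∑ ω, p ω * (Z i ω) ^ 2 := by rw [← Finset.mul_sum, Finset.sum_comm]
      _ ≤ (1 / n) * ∑ i : Fin n, B ^ 2 * BT := by
          gcongr with i
          exact hZ2 i
      _ = B ^ 2 * BT := by simp; field_simp
  · -- pairwise bounds
    have hpair : ∀ i j, ∑ ω, p ω * (Z i ω * Z j ω) ≤
        (if (A i ∩ A j).Nonempty then B ^ 2 * BT else 0) +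
          (if i ≠ j then 4 * B * Φ i j else 0) := by
      intro i j
      have hr : 0 ≤ (if i ≠ j then 4 * B * Φ i j else 0) := by
        split_ifs
        · have := hΦ0 i j; positivity
        · exact le_rfl
      by_cases hA : (A i ∩ A j).Nonempty
      · rw [if_pos hA]
        have : ∑ ω, p ω * (Z i ω * Z j ω) ≤
            (∑ ω, p ω * (Z i ω) ^ 2 + ∑ ω, p ω * (Z j ω) ^ 2) / 2 := by
          rw [← Finset.sum_add_distrib, Finset.sum_div]
          refine Finset.sum_le_sum fun ω _ => ?_
          nlinarith [mul_nonneg (hp ω) (sq_nonneg (Z i ω - Z j ω))]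
        linarith [hZ2 i, hZ2 j]
      · rw [if_neg hA]
        rw [Finset.not_nonempty_iff_eq_empty] at hA
        by_cases hij : i = j
        · subst hij
          have hN : N i = ∅ := by
            rw [Finset.inter_self] at hA
            exact Finset.subset_empty.1 (hA ▸ hA_sub i)
          have hoff : ∀ G : (Fin n → D) → ℝ, Off (N i) G := by
            intro G ω ω' h
            rw [hN] at h
            rw [show ω = ω' from funext fun k => h k (Finset.notMem_empty k)]
          have := key p hp (N i) (dstar i) (hpos i) (fun ω => F i ω ^ 2 * (W i ω - 1)) (hoff _)
          rw [← sub_eq_zero, ← Finset.sum_sub_distrib] at this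
          have h0 : ∑ ω, p ω * (Z i ω * Z i ω) = 0 := by
            rw [← this]
            exact Finset.sum_congr rfl fun ω _ => by simp only [hZ, hW]; ring
          rw [h0]; linarith
        · rw [if_pos hij, zero_add]
          have hdA : Disjoint (A i) (A j) := Finset.disjoint_iff_inter_eq_empty.2 hA
          have hd : Disjoint (N i) (N j) := hdA.mono (hA_sub i) (hA_sub j)
          have o1 := osc_off (N j) (A i) (dstar j) (Y j) (N i)
            ((hA_sub i).trans Finset.subset_union_right)
          have o2 := osc_off (N j) (A i) (dstar j) (Y j) (N j) Finset.subset_union_left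
          have := pair_bound p hp (N i) (N j) hd (dstar i) (dstar j) (hpos i) (hpos j)
            (hci i j hij hA) (F i) (F j) _ (osc (N j) (A i) (dstar j) (Y j)) B (hFoff i) (hFB i)
            o1.1 o1.2 o2.2 (fun ω => osc_bound (N j) (A i) (dstar j) (Y j) ω)
          refine this.trans ?_
          have : ∑ ω, p ω * osc (N j) (A i) (dstar j) (Y j) ω ≤ Φ i j :=
            Finset.sum_le_sum fun ω _ => mul_le_mul_of_nonneg_left (le_abs_self _) (hp ω)
          gcongr
    have hexp : ∑ ω, p ω * (Vhat p N dstar Y ω - Vstar N dstar Y ω) ^ 2 =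
        (1 / (n : ℝ)) ^ 2 * ∑ i, ∑ j, ∑ ω, p ω * (Z i ω * Z j ω) := by
      have : ∀ ω, p ω * (Vhat p N dstar Y ω - Vstar N dstar Y ω) ^ 2 =
          (1 / (n : ℝ)) ^ 2 * ∑ i, ∑ j, p ω * (Z i ω * Z j ω) := by
        intro ω
        rw [hX, mul_pow, sq (∑ i, Z i ω), Finset.sum_mul_sum]
        simp only [← Finset.mul_sum]
        ring
      simp only [this]
      rw [← Finset.mul_sum, Finset.sum_comm]
      congr 1
      exact Finset.sum_congr rfl fun i _ => Finset.sum_comm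
    have hS1 : ∑ i, ∑ j, (if (A i ∩ A j).Nonempty then B ^ 2 * BT else 0) ≤
        n * (An * (B ^ 2 * BT)) := by
      calc _ ≤ ∑ i : Fin n, An * (B ^ 2 * BT) := by
            refine Finset.sum_le_sum fun i _ => ?_
            rw [← Finset.sum_filter, Finset.sum_const, nsmul_eq_mul]
            exact mul_le_mul_of_nonneg_right (hA_card i) (by positivity)
        _ = _ := by simp
    have hS2 : ∑ i, ∑ j, (if i ≠ j then 4 * B * Φ i j else 0) ≤ n * (4 * B * (n * Cn)) := by
      rw [Finset.sum_comm]
      calc _ ≤ ∑ j : Fin n, 4 * B * (n * Cn) := by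
            refine Finset.sum_le_sum fun j _ => ?_
            rw [← Finset.sum_filter, ← Finset.mul_sum]
            exact mul_le_mul_of_nonneg_left (hosc' j) (by positivity)
        _ = _ := by simp
    rw [hexp]
    calc _ ≤ (1 / (n : ℝ)) ^ 2 * (n * (An * (B ^ 2 * BT)) + n * (4 * B * (n * Cn))) := by
          refine mul_le_mul_of_nonneg_left ?_ (by positivity)
          refine le_trans (Finset.sum_le_sum fun i _ => Finset.sum_le_sum fun j _ => hpair i j) ?_
          simp only [Finset.sum_add_distrib]
          exact add_le_add hS1 hS2
      _ = _ := by field_simp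

lemma chebyshev {D : Type*} [Fintype D] {n : ℕ}
    (p : (Fin n → D) → ℝ) (hp : ∀ ω, 0 ≤ p ω) (X : (Fin n → D) → ℝ) (ε : ℝ) (hε : 0 < ε) :
    probEvent p (fun ω => ε < |X ω|) ≤ (∑ ω, p ω * (X ω) ^ 2) / ε ^ 2 := by
  rw [le_div_iff₀ (by positivity)]
  unfold probEvent
  rw [Finset.sum_mul]
  refine Finset.sum_le_sum fun ω _ => ?_
  split_ifs with h
  · refine mul_le_mul_of_nonneg_left ?_ (hp ω)
    rw [← sq_abs (X ω)]
    gcongr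
  · rw [zero_mul]; exact mul_nonneg (hp ω) (sq_nonneg _)

/-- **Consistency of the IPW estimator for the conditional-on-assignment average
counterfactual**: under positivity (rate `B_{T,n}`), bounded dependency neighborhoods
(rate `A_n`) and bounded influence (rate `C_n`) with `B_{T,n} A_n / n → 0` and
`B_{T,n} C_n² → 0`, `V̂_n − V*_n → 0` in probability. -/
theorem consistency
    (B_Y : ℝ) (hBY : 0 < B_Y)
    (D : ℕ → Type) [∀ n, Fintype (D n)] [∀ n, DecidableEq (D n)] [∀ n, Nonempty (D n)]
    (p : ∀ n, (Fin n → D n) → ℝ)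
    (N : ∀ n, Fin n → Finset (Fin n))
    (dstar : ∀ n, ∀ i : Fin n, ↥(N n i) → D n)
    (Y : ∀ n, Fin n → (Fin n → D n) → ℝ)
    (A : ∀ n, Fin n → Finset (Fin n))
    (BT An Cn : ℕ → ℝ)
    -- π₀ is a probability mass function
    (hp0 : ∀ n, 1 ≤ n → ∀ ω, 0 ≤ p n ω)
    (hp1 : ∀ n, 1 ≤ n → ∑ ω, p n ω = 1)
    -- bounded potential outcomes
    (hY : ∀ n, 1 ≤ n → ∀ i ω, |Y n i ω| ≤ B_Y)
    -- positivity of the designated configuration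
    (hpos : ∀ n, 1 ≤ n → ∀ i b, 0 < margOff (p n) (N n i) b →
      0 < condProb (p n) (N n i) (dstar n i) b)
    -- (i) variance of the weights bounded by B_{T,n}
    (hvar : ∀ n, 1 ≤ n → ∀ i, var (p n) (weight (p n) (N n i) (dstar n i)) ≤ BT n)
    -- (ii) dependency neighborhoods A(i) ⊇ N(i)
    (hA_sub : ∀ n, 1 ≤ n → ∀ i, N n i ⊆ A n i)
    (hA_indep : ∀ n, 1 ≤ n → ∀ i, indep (p n) ((A n i)ᶜ) (N n i))
    (hA_card : ∀ n, 1 ≤ n → ∀ i,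
      ((Finset.univ.filter fun j => (A n i ∩ A n j).Nonempty).card : ℝ) ≤ An n)
    (hA_condindep : ∀ n, 1 ≤ n → ∀ i j, i ≠ j → A n i ∩ A n j = ∅ →
      condIndep (p n) (N n i) (N n j) ((N n i ∪ N n j)ᶜ))
    -- (iii) bounded influence: (1/n) Σ_{i ≠ j} E|φ_{ij}| ≤ C_n for every j
    (hosc : ∀ n, 1 ≤ n → ∀ j,
      ((1 : ℝ) / n) * ∑ i ∈ Finset.univ.filter (· ≠ j),
          expect (p n) (fun ω => |osc (N n j) (A n i) (dstar n j) (Y n j) ω|) ≤ Cn n)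
    -- rate conditions
    (hrate1 : Tendsto (fun n => BT n * An n / n) atTop (𝓝 0))
    (hrate2 : Tendsto (fun n => BT n * (Cn n) ^ 2) atTop (𝓝 0)) :
    ∀ ε > (0 : ℝ),
      Tendsto (fun n => probEvent (p n)
          (fun ω => ε < |Vhat (p n) (N n) (dstar n) (Y n) ω - Vstar (N n) (dstar n) (Y n) ω|))
        atTop (𝓝 0) := by
  intro ε hε
  have hsm := fun n (hn : 1 ≤ n) => second_moment hn (p n) (hp0 n hn) (hp1 n hn) (N n) (dstar n)
    (Y n) (A n) B_Y (BT n) (An n) (Cn n) hBY (hY n hn) (hpos n hn) (hvar n hn) (hA_sub n hn)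
    (hA_card n hn) (hA_condindep n hn) (hosc n hn)
  rw [Metric.tendsto_atTop']
  intro η hη
  -- target for the second moment
  obtain ⟨δ, hδ, hδη⟩ : ∃ δ > 0, δ / ε ^ 2 < η :=
    ⟨η * ε ^ 2 / 2, by positivity, by field_simp; norm_num⟩
  have hτ : 0 < δ / (2 * B_Y ^ 2) := by positivity
  have ev1 := hrate1.eventually (gt_mem_nhds (show 0 < δ / (2 * B_Y ^ 2) by positivity))
  have ev2 := hrate2.eventually
    (gt_mem_nhds (show 0 < δ / (2 * B_Y ^ 2) * (δ / (8 * B_Y)) ^ 2 by positivity))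
  obtain ⟨M, hM⟩ := eventually_atTop.1 (ev1.and (ev2.and (eventually_ge_atTop 1)))
  refine ⟨M, fun n hn => ?_⟩
  obtain ⟨h1, h2, h3⟩ := hM n hn.le
  obtain ⟨hBT, hCn, b1, b2⟩ := hsm n h3
  have hmom : ∑ ω, p n ω * (Vhat (p n) (N n) (dstar n) (Y n) ω -
      Vstar (N n) (dstar n) (Y n) ω) ^ 2 ≤ δ := by
    rcases le_total (BT n) (δ / (2 * B_Y ^ 2)) with h | h
    · refine b1.trans ?_
      calc B_Y ^ 2 * BT n ≤ B_Y ^ 2 * (δ / (2 * B_Y ^ 2)) := by gcongr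
        _ = δ / 2 := by field_simp
        _ ≤ δ := by linarith
    · have hC : Cn n ≤ δ / (8 * B_Y) := by
        have h4 : δ / (2 * B_Y ^ 2) * (Cn n) ^ 2 ≤
            δ / (2 * B_Y ^ 2) * (δ / (8 * B_Y)) ^ 2 :=
          (mul_le_mul_of_nonneg_right h (sq_nonneg _)).trans h2.le
        exact (pow_le_pow_iff_left₀ hCn (by positivity) two_ne_zero).1 (le_of_mul_le_mul_left h4 hτ)
      refine b2.trans ?_
      calc B_Y ^ 2 * (BT n * An n / n) + 4 * B_Y * Cn n
          ≤ B_Y ^ 2 * (δ / (2 * B_Y ^ 2)) + 4 * B_Y * (δ / (8 * B_Y)) := by gcongr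
        _ = δ := by field_simp; norm_num
  have hch := chebyshev (p n) (hp0 n h3) (fun ω => Vhat (p n) (N n) (dstar n) (Y n) ω -
      Vstar (N n) (dstar n) (Y n) ω) ε hε
  have hnn : 0 ≤ probEvent (p n) (fun ω => ε < |Vhat (p n) (N n) (dstar n) (Y n) ω -
      Vstar (N n) (dstar n) (Y n) ω|) :=
    Finset.sum_nonneg fun ω _ => by split_ifs; exacts [hp0 n h3 ω, le_rfl]
  rw [Real.dist_eq, sub_zero, abs_of_nonneg hnn]
  refine lt_of_le_of_lt (hch.trans ?_) hδη
  gcongr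

end Stmt1
end
end

section
/- Let G be a simple graph on Fin n, and let H and K be n×n real matrices such that H_{ij} ≠ 0 only if i and j are adjacent in G, and K_{ij} ≠ 0 only if i = j or i and j are adjacent in G. Assume I − H is invertible, and set M := (I − H)⁻¹·K. For s ≥ 0 let L̃_s be the matrix with (L̃_s)_{ij} = 1 if i and j are connected in G at graph distance exactly s and 0 otherwise (so L̃_0 = I). Then: (i) M_{ij} = 0 whenever i and j are not connected in G; and (ii) the total effect decomposes into distance-specific effects: (1/n)·Σ_i Σ_j M_{ij} = Σ_{s=0}^{n−1} (1/n)·tr(M·L̃_s). -/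
open Finset Matrix
open scoped BigOperators Classical

noncomputable section

/-- The indicator matrix of graph distance exactly `s` (so `L̃_0 = I`). -/
def distMatrix {n : ℕ} (G : SimpleGraph (Fin n)) (s : ℕ) : Matrix (Fin n) (Fin n) ℝ :=
  Matrix.of fun i j => if G.Reachable i j ∧ G.dist i j = s then (1 : ℝ) else 0

/-- **Decomposition of the total effect into distance-specific conditional average exposure
effects.** With `H` supported on the edges of `G`, `K` supported on the edges and diagonal,
`I − H` invertible and `M = (I − H)⁻¹·K`: (i) `M_{ij} = 0` for unreachable pairs, and
(ii) `(1/n)·Σ_{ij} M_{ij} = Σ_{s<n} (1/n)·tr(M·L̃_s)`, i.e. `τ_tot = τ_dir + τ_1 + ⋯ + τ_S`. -/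
theorem total_effect_decomposition
    (n : ℕ) (G : SimpleGraph (Fin n))
    (H K : Matrix (Fin n) (Fin n) ℝ)
    (hH : ∀ i j, H i j ≠ 0 → G.Adj i j)
    (hK : ∀ i j, K i j ≠ 0 → i = j ∨ G.Adj i j)
    (hinv : IsUnit (1 - H))
    (M : Matrix (Fin n) (Fin n) ℝ)
    (hM : M = (1 - H)⁻¹ * K) :
    (∀ i j, ¬ G.Reachable i j → M i j = 0) ∧
      ((1 : ℝ) / n) * ∑ i, ∑ j, M i j =
        ∑ s ∈ Finset.range n, ((1 : ℝ) / n) * Matrix.trace (M * distMatrix G s) := by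
  have hA : ∀ i k, ¬ G.Reachable i k → (1 - H) i k = 0 := by
    intro i k h
    have h1 : i ≠ k := by
      rintro rfl
      exact h (SimpleGraph.Reachable.refl _)
    have h2 : H i k = 0 := by
      by_contra h3
      exact h (hH i k h3).reachable
    simp [Matrix.sub_apply, Matrix.one_apply_ne h1, h2]
  have hmul : (1 - H) * M = K := by
    rw [hM, ← Matrix.mul_assoc, Matrix.mul_nonsing_inv _ ((Matrix.isUnit_iff_isUnit_det _).1 hinv),
      Matrix.one_mul]
  have part1 : ∀ i j, ¬ G.Reachable i j → M i j = 0 := by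
    intro i j hij
    let v : Fin n → ℝ := fun k => if G.Reachable k j then 0 else M k j
    have hv : (1 - H) *ᵥ v = 0 := by
      funext a
      by_cases ha : G.Reachable a j
      · simp only [Matrix.mulVec, dotProduct, Pi.zero_apply]
        refine Finset.sum_eq_zero fun k _ => ?_
        by_cases hk : G.Reachable k j
        · simp [v, hk]
        · rw [hA a k (fun h => hk (h.symm.trans ha)), zero_mul]
      · have hK0 : K a j = 0 := by
          by_contra h3
          rcases hK a j h3 with h | h
          · exact ha (h ▸ SimpleGraph.Reachable.refl _)
          · exact ha h.reachable
        rw [← hmul, Matrix.mul_apply] at hK0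
        simp only [Matrix.mulVec, dotProduct, Pi.zero_apply]
        rw [← hK0]
        refine Finset.sum_congr rfl fun k _ => ?_
        by_cases hk : G.Reachable k j
        · rw [hA a k (fun h => ha (h.trans hk)), zero_mul, zero_mul]
        · simp [v, hk]
    have hv0 : v = 0 := by
      apply Matrix.mulVec_injective_of_isUnit hinv
      simpa using hv
    have := congrFun hv0 i
    simpa [v, hij] using this
  refine ⟨part1, ?_⟩
  rw [← Finset.mul_sum]
  congr 1
  simp only [Matrix.trace, Matrix.diag_apply, Matrix.mul_apply]
  rw [Finset.sum_comm]
  rw [Finset.sum_comm]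
  rw [Finset.sum_comm (s := Finset.range n)]
  refine Finset.sum_congr rfl fun i _ => ?_
  rw [Finset.sum_comm]
  refine Finset.sum_congr rfl fun j _ => ?_
  by_cases h : G.Reachable i j
  · have hlt : G.dist j i < n := by
      obtain ⟨p, hp, hl⟩ := h.symm.exists_path_of_dist
      have := hp.length_lt
      simp only [Fintype.card_fin] at this
      omega
    simp [distMatrix, h.symm, hlt]
  · simp [part1 i j h]
end
end

section
/- Let L be an n×n real matrix with zero diagonal and γ₂ a real constant with I − γ₂·L invertible. If tr(L·(I − γ₂·L)⁻¹·L) ≠ 0, then tr((I − γ₂·L)⁻¹·L) / tr(L·(I − γ₂·L)⁻¹·L) = γ₂. Consequently, in the linear-in-means model with γ₁ = 0 and β₁ ≠ 0, the ratio of the conditional average exposure effect on Y_i of treating all of unit i's neighbors, τ_Y = (t/n)·tr((I − γ₂L)⁻¹·β₁·L), to the corresponding effect on (LY)_i, τ_{LY} = (t/n)·tr(L·(I − γ₂L)⁻¹·β₁·L), identifies the endogenous peer-effect parameter γ₂. -/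
open Finset Matrix
open scoped BigOperators

noncomputable section

/-- **Identification of the endogenous peer-effect parameter `γ₂` in the linear-in-means
model.** For hollow `L` with `I − γ₂L` invertible and `tr(L(I−γ₂L)⁻¹L) ≠ 0`,
`tr((I−γ₂L)⁻¹L) / tr(L(I−γ₂L)⁻¹L) = γ₂`; consequently the ratio of the conditional average
exposure effects `τ_Y = (t/n)tr((I−γ₂L)⁻¹β₁L)` and `τ_{LY} = (t/n)tr(L(I−γ₂L)⁻¹β₁L)`
identifies `γ₂`. -/
theorem linear_in_means_gamma2
    (n : ℕ) (hn : 0 < n)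
    (L : Matrix (Fin n) (Fin n) ℝ)
    (hL_diag : ∀ i, L i i = 0)
    (γ₂ : ℝ)
    (hinv : IsUnit (1 - γ₂ • L))
    (htr : Matrix.trace (L * (1 - γ₂ • L)⁻¹ * L) ≠ 0)
    (t β₁ : ℝ) (ht : t ≠ 0) (hβ : β₁ ≠ 0)
    (τY τLY : ℝ)
    (hτY : τY = (t / n) * Matrix.trace ((1 - γ₂ • L)⁻¹ * (β₁ • L)))
    (hτLY : τLY = (t / n) * Matrix.trace (L * (1 - γ₂ • L)⁻¹ * (β₁ • L))) :
    Matrix.trace ((1 - γ₂ • L)⁻¹ * L) / Matrix.trace (L * (1 - γ₂ • L)⁻¹ * L) = γ₂ ∧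
      τY / τLY = γ₂ := by
  have hdet : IsUnit (1 - γ₂ • L).det := (Matrix.isUnit_iff_isUnit_det _).1 hinv
  have h1 : (1 - γ₂ • L) * (1 - γ₂ • L)⁻¹ = 1 := Matrix.mul_nonsing_inv _ hdet
  generalize (1 - γ₂ • L)⁻¹ = R at *
  have h2 : R = 1 + γ₂ • (L * R) := by
    rw [Matrix.sub_mul, Matrix.one_mul, Matrix.smul_mul] at h1
    exact sub_eq_iff_eq_add.1 h1
  have h3 : R * L = L + γ₂ • (L * R * L) := by
    conv_lhs => rw [h2]
    rw [Matrix.add_mul, Matrix.one_mul, Matrix.smul_mul]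
  have h0 : Matrix.trace L = 0 := by simp [Matrix.trace, hL_diag]
  have h4 : Matrix.trace (R * L) = γ₂ * Matrix.trace (L * R * L) := by
    rw [h3, Matrix.trace_add, h0, Matrix.trace_smul, zero_add, smul_eq_mul]
  have hn' : (n : ℝ) ≠ 0 := by exact_mod_cast hn.ne'
  refine ⟨by rw [h4]; field_simp, ?_⟩
  rw [hτY, hτLY, Matrix.mul_smul, Matrix.mul_smul, Matrix.trace_smul, Matrix.trace_smul, h4,
    smul_eq_mul, smul_eq_mul]
  field_simp
end
end

section
/- Let L be an n×n real matrix and γ₂, β₁ real constants with I − γ₂·L invertible. Then β₁ = (1/n)·tr(β₁·(I − γ₂·L)⁻¹) − γ₂·(1/n)·tr(β₁·L·(I − γ₂·L)⁻¹). Consequently, in the linear-in-means model the direct-effect parameter β₁ is recovered from the conditional average direct effect of D_i on Y_i, τ_dir = (t/n)·tr((I − γ₂L)⁻¹·β₁), and the conditional average direct effect of D_i on (LY)_i, τ_{LY}^{(0)} = (t/n)·tr(L·(I − γ₂L)⁻¹·β₁), via β₁ = t⁻¹·(τ_dir − γ₂·τ_{LY}^{(0)}). -/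
open Finset Matrix
open scoped BigOperators

noncomputable section

/-- **Recovery of the direct-effect parameter `β₁` in the linear-in-means model.** With
`I − γ₂L` invertible, `β₁ = (1/n)tr(β₁(I−γ₂L)⁻¹) − γ₂·(1/n)tr(β₁L(I−γ₂L)⁻¹)`; consequently
`β₁ = t⁻¹(τ_dir − γ₂ τ_{LY}^{(0)})` for the conditional average direct effects
`τ_dir = (t/n)tr((I−γ₂L)⁻¹β₁)` and `τ_{LY}^{(0)} = (t/n)tr(L(I−γ₂L)⁻¹β₁)`. -/
theorem linear_in_means_beta1
    (n : ℕ) (hn : 0 < n)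
    (L : Matrix (Fin n) (Fin n) ℝ)
    (γ₂ β₁ : ℝ)
    (hinv : IsUnit (1 - γ₂ • L))
    (t : ℝ) (ht : t ≠ 0)
    (τdir τLY0 : ℝ)
    (hτdir : τdir = (t / n) * Matrix.trace (β₁ • (1 - γ₂ • L)⁻¹))
    (hτLY0 : τLY0 = (t / n) * Matrix.trace (β₁ • (L * (1 - γ₂ • L)⁻¹))) :
    β₁ = ((1 : ℝ) / n) * Matrix.trace (β₁ • (1 - γ₂ • L)⁻¹) -
        γ₂ * (((1 : ℝ) / n) * Matrix.trace (β₁ • (L * (1 - γ₂ • L)⁻¹))) ∧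
      β₁ = t⁻¹ * (τdir - γ₂ * τLY0) := by
  have hn' : (n : ℝ) ≠ 0 := by exact_mod_cast hn.ne'
  have hmul : (1 - γ₂ • L) * (1 - γ₂ • L)⁻¹ = 1 :=
    Matrix.mul_nonsing_inv _ ((Matrix.isUnit_iff_isUnit_det _).1 hinv)
  have key : Matrix.trace ((1 - γ₂ • L)⁻¹) - γ₂ * Matrix.trace (L * (1 - γ₂ • L)⁻¹) = n := by
    have h := congrArg Matrix.trace hmul
    rw [Matrix.sub_mul, Matrix.one_mul, Matrix.smul_mul, Matrix.trace_sub, Matrix.trace_smul,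
      Matrix.trace_one, Fintype.card_fin, smul_eq_mul] at h
    exact h
  subst hτdir hτLY0
  simp only [Matrix.trace_smul, smul_eq_mul]
  generalize Matrix.trace ((1 - γ₂ • L)⁻¹) = a at *
  generalize Matrix.trace (L * (1 - γ₂ • L)⁻¹) = b at *
  constructor
  · field_simp
    linear_combination (-β₁) * key
  · field_simp
    linear_combination (-β₁) * key
end
end

section
/- Let n ≥ 1, 0 < π₀ < 1, and let Y_i : {0,1}ⁿ → ℝ for i = 1,…,n be arbitrary fixed potential-outcome maps. Let D = (D_1,…,D_n) be i.i.d. Bernoulli(π₀) random variables. Define the Horvitz–Thompson estimator τ̂ = (1/n)·Σ_i ( D_i·Y_i(D)/π₀ − (1 − D_i)·Y_i(D)/(1 − π₀) ) and the conditional-on-assignment average direct effect τ(D) = (1/n)·Σ_i ( Y_i(1, D_{−i}) − Y_i(0, D_{−i}) ), where (d, D_{−i}) denotes the assignment with i-th coordinate d and all other coordinates those of D. Then E[τ̂] = E[τ(D)], i.e. the estimator is unbiased for the (random) conditional average direct effect. -/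
open Finset
open scoped BigOperators

noncomputable section

namespace Stmt16

/-- Product Bernoulli(π₀) pmf on binary assignments `ω : Fin n → Bool`. -/
def bernoulliPMF {n : ℕ} (π₀ : ℝ) (ω : Fin n → Bool) : ℝ :=
  ∏ i, if ω i then π₀ else 1 - π₀

lemma bernoulliPMF_update {n : ℕ} (π₀ : ℝ) (ω : Fin n → Bool) (i : Fin n) (b : Bool) :
    bernoulliPMF π₀ (Function.update ω i b) =
      (if b then π₀ else 1 - π₀) * ∏ j ∈ univ.erase i, if ω j then π₀ else 1 - π₀ := by
  unfold bernoulliPMF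
  rw [← Finset.mul_prod_erase univ _ (Finset.mem_univ i)]
  rw [Function.update_self]
  congr 1
  apply Finset.prod_congr rfl
  intro j hj
  rw [Function.update_of_ne (Finset.ne_of_mem_erase hj)]

lemma sum_eq_of_pair {n : ℕ} (i : Fin n) (f g : (Fin n → Bool) → ℝ)
    (h : ∀ ω, f (Function.update ω i true) + f (Function.update ω i false) =
      g (Function.update ω i true) + g (Function.update ω i false)) :
    ∑ ω, f ω = ∑ ω, g ω := by
  have inv : Function.Involutive
      (fun ω : Fin n → Bool => Function.update ω i (!ω i)) := by
    intro ω
    simp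
  have key : ∀ f : (Fin n → Bool) → ℝ, ∑ ω, f ω + ∑ ω, f ω =
      ∑ ω, (f (Function.update ω i true) + f (Function.update ω i false)) := by
    intro f
    have e : ∑ ω, f (Function.update ω i (!ω i)) = ∑ ω, f ω :=
      Equiv.sum_comp inv.toPerm f
    nth_rewrite 2 [← e]
    rw [← Finset.sum_add_distrib]
    apply Finset.sum_congr rfl
    intro ω _
    have hs : Function.update ω i (ω i) = ω := Function.update_eq_self i ω
    cases hb : ω i
    · rw [hb] at hs
      rw [hs]
      simp [add_comm]
    · rw [hb] at hs
      rw [hs]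
      simp
  have h1 := key f
  have h2 := key g
  rw [Finset.sum_congr rfl (fun ω _ => h ω)] at h1
  linarith

/-- **Unbiasedness of the Horvitz–Thompson estimator for the conditional-on-assignment average
direct effect under i.i.d. Bernoulli assignment with unrestricted interference:**
`E[τ̂] = E[τ(D)]`. -/
theorem horvitz_thompson_unbiased
    (n : ℕ) (hn : 1 ≤ n)
    (π₀ : ℝ) (hπ₀ : 0 < π₀) (hπ₀' : π₀ < 1)
    (Y : Fin n → (Fin n → Bool) → ℝ) :
    (∑ ω, bernoulliPMF π₀ ω *
        (((1 : ℝ) / n) * ∑ i,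
          ((if ω i then (1 : ℝ) else 0) * Y i ω / π₀ -
            (if ω i then (0 : ℝ) else 1) * Y i ω / (1 - π₀)))) =
      ∑ ω, bernoulliPMF π₀ ω *
        (((1 : ℝ) / n) * ∑ i,
          (Y i (Function.update ω i true) - Y i (Function.update ω i false))) := by
  have h1 : (1 - π₀) ≠ 0 := by linarith
  have h0 : π₀ ≠ 0 := hπ₀.ne'
  simp only [Finset.mul_sum]
  rw [Finset.sum_comm]
  conv_rhs => rw [Finset.sum_comm]
  apply Finset.sum_congr rfl
  intro i _
  apply sum_eq_of_pair i
  intro ω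
  simp only [bernoulliPMF_update, Function.update_self, Function.update_idem]
  simp only [if_true, Bool.false_eq_true, if_false]
  field_simp
  ring

end Stmt16
end
end
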